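/- The number of monotone Boolean functions of 8 variables that are fixed points of the permutation of Fin 8 given by the product of transpositions (0 1)(2 3)(4 5) equals 7377670895900. -/

import Mathlib

namespace FixedMBF

/-- Truth tables, as 16-bit codes, of the monotone functions of four variables. -/
def monoCodes : List ℕ :=
  [0, 32768, 49152, 40960, 57344, 61440, 34816, 51200, 43008, 59392, 63488, 52224, 60416, 64512,
   43520, 59904, 64000, 60928, 65024, 65280, 32896, 49280, 41088, 57472, 61568, 34944, 51328,
   43136, 59520, 63616, 52352, 60544, 64640, 43648, 60032, 64128, 61056, 65152, 65408, 49344,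
   57536, 61632, 51392, 59584, 63680, 52416, 60608, 64704, 60096, 64192, 61120, 65216, 65472,
   41120, 57504, 61600, 43168, 59552, 63648, 60576, 64672, 43680, 60064, 64160, 61088, 65184,
   65440, 57568, 61664, 59616, 63712, 60640, 64736, 60128, 64224, 61152, 65248, 65504, 61680,
   63728, 64752, 64240, 65264, 65520, 34952, 51336, 43144, 59528, 63624, 52360, 60552, 64648,
   43656, 60040, 64136, 61064, 65160, 65416, 51400, 59592, 63688, 52424, 60616, 64712, 60104,
   64200, 61128, 65224, 65480, 43176, 59560, 63656, 60584, 64680, 43688, 60072, 64168, 61096,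
   65192, 65448, 59624, 63720, 60648, 64744, 60136, 64232, 61160, 65256, 65512, 63736, 64760,
   64248, 65272, 65528, 52428, 60620, 64716, 61132, 65228, 65484, 60652, 64748, 61164, 65260,
   65516, 64764, 65276, 65532, 43690, 60074, 64170, 61098, 65194, 65450, 60138, 64234, 61162,
   65258, 65514, 64250, 65274, 65530, 61166, 65262, 65518, 65278, 65534, 65535]

/-- The members of `monoCodes` that are invariant under `(0 1)(2 3)`. -/
def symCodes : List ℕ :=
  [0, 32768, 57344, 61440, 34944, 59520, 63616, 60096, 64192, 60576, 64672, 61152, 65248, 65520,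
   34952, 59528, 63624, 60104, 64200, 60584, 64680, 61160, 65256, 65528, 61166, 65262, 65534,
   65535]

/-- The pointwise order on truth tables. -/
def codeLE (x y : ℕ) : Bool := Nat.beq (Nat.land x y) x

/-! The evaluation functions are written with explicit recursors and the binary operations on `ℕ`
that the kernel implements natively. -/

/-- Application of `k` to `n`, arranged so that the kernel evaluates `n` to a literal first. -/
noncomputable def force (n : ℕ) (k : ℕ → ℕ) : ℕ := Nat.rec (k 0) (fun m _ => k (Nat.succ m)) n

noncomputable def sumL (l : List ℕ) (f : ℕ → ℕ) : ℕ :=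
  List.rec 0 (fun a _ ih => Nat.add (f a) ih) l

noncomputable def filt (p : ℕ → Bool) (l : List ℕ) : List ℕ :=
  List.rec [] (fun a _ ih => Bool.rec ih (a :: ih) (p a)) l

def radix : ℕ := Nat.pow 2 80

/-- The number whose base-`radix` digits are the values of `f` along `l`. -/
noncomputable def pack (l : List ℕ) (f : ℕ → ℕ) : ℕ :=
  List.rec 0 (fun a _ ih => Nat.add (f a) (Nat.mul radix ih)) l

def swap01 (m : ℕ) : ℕ :=
  Nat.lor (Nat.land m 39321) (Nat.lor (Nat.mul (Nat.land m 8738) 2) (Nat.div (Nat.land m 17476) 2))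

def swap23 (m : ℕ) : ℕ :=
  Nat.lor (Nat.land m 61455) (Nat.lor (Nat.mul (Nat.land m 240) 16) (Nat.div (Nat.land m 3840) 16))

/-- The largest invariant code below `m`. -/
def floorSym (m : ℕ) : ℕ := Nat.land m (swap23 (swap01 m))

/-- The smallest invariant code above `m`. -/
def ceilSym (m : ℕ) : ℕ := Nat.lor m (swap23 (swap01 m))

noncomputable def between (x w : ℕ) : List ℕ :=
  filt (fun z => codeLE z w) (filt (codeLE x) symCodes)

noncomputable def upRow (z : ℕ) : ℕ := pack monoCodes fun c => Bool.toNat (codeLE z c)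

noncomputable def downRow (z : ℕ) : ℕ := pack monoCodes.reverse fun c => Bool.toNat (codeLE c z)

noncomputable def upMask (a : ℕ) : ℕ :=
  pack monoCodes.reverse fun c => Nat.mul (Nat.sub radix 1) (Bool.toNat (codeLE a c))

noncomputable def downMask (d : ℕ) : ℕ :=
  pack monoCodes.reverse fun c => Nat.mul (Nat.sub radix 1) (Bool.toNat (codeLE c d))

noncomputable def upTerm (x w q : ℕ) : ℕ :=
  Nat.mul (sumL (between x w) fun y => Bool.toNat (codeLE y q)) (sumL (between x w) upRow)

noncomputable def downTerm (x w q : ℕ) : ℕ :=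
  Nat.mul (sumL (between x w) fun y => Bool.toNat (codeLE q y)) (sumL (between x w) downRow)

noncomputable def belowInner (p q w : ℕ) : ℕ :=
  sumL (filt (fun x => codeLE x w) (filt (fun x => codeLE x p) symCodes)) fun x => upTerm x w q

/-- The packed vector, over `c`, of the number of squares `x ≤ y, z ≤ w` of invariant codes with
`x ≤ p`, `y ≤ q`, `z ≤ c`, `w ≤ s`. -/
noncomputable def below (p q s : ℕ) : ℕ :=
  sumL (filt (fun w => codeLE w s) symCodes) fun w => belowInner p q w

noncomputable def aboveInner (p q w : ℕ) : ℕ :=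
  sumL (between p w) fun x => downTerm x w q

/-- The reversed packed vector, over `c`, of the number of squares `x ≤ y, z ≤ w` of invariant
codes with `p ≤ x`, `q ≤ y`, `c ≤ z`, `s ≤ w`. -/
noncomputable def above (p q s : ℕ) : ℕ :=
  sumL (filt (codeLE s) symCodes) fun w => aboveInner p q w

noncomputable def total (l : List ℕ) : ℕ :=
  sumL l fun a =>
    force (floorSym a) fun ha => force (ceilSym a) fun ka =>
      sumL (filt (codeLE a) monoCodes) fun b =>
        force (floorSym b) fun hb => force (ceilSym b) fun kb =>
          sumL (filt (codeLE b) monoCodes) fun d =>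
            force (floorSym d) fun hd => force (ceilSym d) fun kd =>
              Nat.mul (below ha hb hd)
                (Nat.land (above ka kb kd) (Nat.land (upMask a) (downMask d)))

theorem force_eq (n : ℕ) (k : ℕ → ℕ) : force n k = k n := by cases n <;> rfl

theorem filt_eq (p : ℕ → Bool) (l : List ℕ) : filt p l = l.filter p := by
  induction l with
  | nil => rfl
  | cons a l ih =>
    rw [List.filter_cons, ← ih]
    change @Bool.rec (fun _ => List ℕ) (filt p l) (a :: filt p l) (p a) = _
    cases p a <;> rfl

@[simp] theorem sumL_nil (f : ℕ → ℕ) : sumL [] f = 0 := rfl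

@[simp] theorem sumL_cons (a : ℕ) (l : List ℕ) (f : ℕ → ℕ) :
    sumL (a :: l) f = f a + sumL l f := rfl

@[simp] theorem pack_nil (f : ℕ → ℕ) : pack [] f = 0 := rfl

@[simp] theorem pack_cons (a : ℕ) (l : List ℕ) (f : ℕ → ℕ) :
    pack (a :: l) f = f a + radix * pack l f := rfl

theorem sumL_append (l r : List ℕ) (f : ℕ → ℕ) : sumL (l ++ r) f = sumL l f + sumL r f := by
  induction l with
  | nil => simp
  | cons a l ih => simp [ih, add_assoc]

theorem sumL_eq_sum {l : List ℕ} (hl : l.Nodup) (f : ℕ → ℕ) :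
    sumL l f = ∑ a ∈ l.toFinset, f a := by
  rw [List.sum_toFinset f hl]
  induction l with
  | nil => rfl
  | cons a l ih => simp [ih hl.of_cons]

theorem sumL_congr {l : List ℕ} {f g : ℕ → ℕ} (h : ∀ a ∈ l, f a = g a) : sumL l f = sumL l g := by
  induction l with
  | nil => rfl
  | cons a l ih => simp_all

theorem sumL_le {l : List ℕ} {f : ℕ → ℕ} {n M : ℕ} (hl : l.length ≤ n) (h : ∀ a ∈ l, f a ≤ M) :
    sumL l f ≤ n * M := by
  refine le_trans ?_ (Nat.mul_le_mul_right M hl)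
  induction l with
  | nil => simp
  | cons a l ih =>
    have h1 := h a (by simp)
    have h2 := ih (by simp at hl; lia) fun b hb => h b (by simp [hb])
    simp only [sumL_cons, List.length_cons, Nat.add_mul, one_mul]
    lia

theorem pack_add (l : List ℕ) (f g : ℕ → ℕ) :
    pack l f + pack l g = pack l fun c => f c + g c := by
  induction l with
  | nil => rfl
  | cons a l ih => simp only [pack_cons, ← ih]; ring

theorem mul_pack (l : List ℕ) (k : ℕ) (f : ℕ → ℕ) : k * pack l f = pack l fun c => k * f c := by
  induction l with
  | nil => rfl
  | cons a l ih => simp only [pack_cons, ← ih]; ring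

theorem pack_zero (l : List ℕ) : pack l (fun _ => 0) = 0 := by
  induction l with
  | nil => rfl
  | cons a l ih => simp [ih]

theorem sumL_pack (l r : List ℕ) (g : ℕ → ℕ → ℕ) :
    sumL l (fun z => pack r (g z)) = pack r fun c => sumL l fun z => g z c := by
  induction l with
  | nil => simp [pack_zero]
  | cons a l ih => simp only [sumL_cons, ih, pack_add]

theorem pack_concat (l : List ℕ) (a : ℕ) (f : ℕ → ℕ) :
    pack (l ++ [a]) f = pack l f + radix ^ l.length * f a := by
  induction l with
  | nil => simp
  | cons b l ih => simp only [List.cons_append, pack_cons, ih, List.length_cons, pow_succ]; ring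

theorem radix_pos : 0 < radix := by decide

theorem land_pack (l : List ℕ) {f g : ℕ → ℕ} (hf : ∀ c ∈ l, f c < radix)
    (hg : ∀ c ∈ l, g c < radix) :
    pack l f &&& pack l g = pack l fun c => f c &&& g c := by
  induction l with
  | nil => simp
  | cons a l ih =>
    have hr : radix = 2 ^ 80 := rfl
    simp only [List.mem_cons, forall_eq_or_imp] at hf hg
    simp only [pack_cons, ← ih hf.2 hg.2]
    rw [hr] at hf hg ⊢
    refine Nat.eq_of_testBit_eq fun i => ?_
    have h1 : f a &&& g a < 2 ^ 80 := Nat.and_lt_two_pow _ hg.1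
    rw [Nat.testBit_and, add_comm (f a), add_comm (g a), add_comm (f a &&& g a),
      Nat.testBit_two_pow_mul_add _ hf.1, Nat.testBit_two_pow_mul_add _ hg.1,
      Nat.testBit_two_pow_mul_add _ h1]
    split_ifs <;> simp

theorem radix_mul_pack_reverse_le (l : List ℕ) (g : ℕ → ℕ) :
    radix * pack l.reverse g ≤ radix ^ l.length * sumL l g := by
  induction l with
  | nil => simp
  | cons a l ih =>
    have h1 : 1 ≤ radix := radix_pos
    simp only [List.reverse_cons, pack_concat, List.length_reverse, List.length_cons, sumL_cons,
      pow_succ]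
    calc radix * (pack l.reverse g + radix ^ l.length * g a)
        = radix * pack l.reverse g + radix ^ l.length * radix * g a := by ring
      _ ≤ radix ^ l.length * radix * sumL l g + radix ^ l.length * radix * g a := by
          refine Nat.add_le_add_right (ih.trans (Nat.mul_le_mul_right _ ?_)) _
          exact Nat.le_mul_of_pos_right _ radix_pos
      _ = _ := by ring

/-- `D` is the coefficient of `radix ^ (n - 1)` in `S`, all coefficients of `S` being at most
`T`. -/
def HasCoeff (n S D T : ℕ) : Prop :=
  ∃ L H, radix * S = L + radix ^ n * D + radix ^ (n + 1) * H ∧ radix * L ≤ radix ^ n * T ∧ D ≤ T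

theorem HasCoeff.mono {n S D T T' : ℕ} (h : HasCoeff n S D T) (hT : T ≤ T') :
    HasCoeff n S D T' := by
  obtain ⟨L, H, h1, h2, h3⟩ := h
  exact ⟨L, H, h1, h2.trans (Nat.mul_le_mul_left _ hT), h3.trans hT⟩

theorem HasCoeff.add {n S D T S' D' T' : ℕ} (h : HasCoeff n S D T) (h' : HasCoeff n S' D' T') :
    HasCoeff n (S + S') (D + D') (T + T') := by
  obtain ⟨L, H, h1, h2, h3⟩ := h
  obtain ⟨L', H', h1', h2', h3'⟩ := h'
  refine ⟨L + L', H + H', ?_, ?_, by lia⟩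
  · rw [mul_add, h1, h1']; ring
  · rw [mul_add, mul_add]; lia

theorem HasCoeff.sumL {n N T : ℕ} {l : List ℕ} {S D : ℕ → ℕ} (hl : l.length ≤ N)
    (h : ∀ a ∈ l, HasCoeff n (S a) (D a) T) :
    HasCoeff n (sumL l S) (sumL l D) (N * T) := by
  refine HasCoeff.mono ?_ (Nat.mul_le_mul_right T hl)
  clear hl
  induction l with
  | nil => exact ⟨0, 0, by simp⟩
  | cons a l ih =>
    have := (h a (by simp)).add (ih fun b hb => h b (by simp [hb]))
    simpa [Nat.add_mul, add_comm] using this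

theorem HasCoeff.pack_mul_pack (l : List ℕ) (f g : ℕ → ℕ) :
    HasCoeff l.length (pack l f * pack l.reverse g) (FixedMBF.sumL l fun c => f c * g c)
      (FixedMBF.sumL l f * FixedMBF.sumL l g) := by
  induction l with
  | nil => exact ⟨0, 0, by simp⟩
  | cons a l ih =>
    obtain ⟨L, H, h1, h2, h3⟩ := ih
    have hr := radix_mul_pack_reverse_le l g
    simp only [List.reverse_cons, pack_cons, pack_concat, List.length_reverse, List.length_cons,
      sumL_cons]
    generalize pack l f = P at *
    generalize pack l.reverse g = Q at *
    refine ⟨radix * (L + f a * Q), H + g a * P, ?_, ?_, ?_⟩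
    · calc _ = radix * (f a * Q + radix ^ l.length * (f a * g a)
            + radix ^ (l.length + 1) * (g a * P) + radix * (P * Q)) := by ring
        _ = _ := by rw [h1]; ring
    · calc radix * (radix * (L + f a * Q))
          = radix * (radix * L + f a * (radix * Q)) := by ring
        _ ≤ radix * (radix ^ l.length * (FixedMBF.sumL l f * FixedMBF.sumL l g)
              + f a * (radix ^ l.length * FixedMBF.sumL l g)) := by gcongr
        _ = radix ^ (l.length + 1) * ((f a + FixedMBF.sumL l f) * FixedMBF.sumL l g) := by ring
        _ ≤ _ := by gcongr; lia
    · calc _ ≤ f a * g a + FixedMBF.sumL l f * FixedMBF.sumL l g := by gcongr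
        _ ≤ _ := by ring_nf; lia

theorem HasCoeff.eq_mod {n S D T : ℕ} (h : HasCoeff (n + 1) S D T) (hT : T < radix) :
    D = S / radix ^ n % radix := by
  obtain ⟨L, H, h1, h2, h3⟩ := h
  have hL : L < radix ^ (n + 1) := by
    by_contra! hc
    have h4 : radix * radix ^ (n + 1) ≤ radix ^ (n + 1) * T := (Nat.mul_le_mul_left _ hc).trans h2
    rw [mul_comm] at h4
    exact absurd (Nat.le_of_mul_le_mul_left h4 (Nat.pow_pos radix_pos)) (by lia)
  have h5 : radix * S = radix ^ (n + 1) * (D + radix * H) + L := by rw [h1]; ring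
  have h6 : S / radix ^ n = D + radix * H := by
    rw [← Nat.mul_div_mul_left S (radix ^ n) radix_pos, ← pow_succ', h5,
      Nat.mul_add_div (Nat.pow_pos radix_pos), Nat.div_eq_of_lt hL, add_zero]
  rw [h6, Nat.add_mul_mod_self_left, Nat.mod_eq_of_lt (by lia)]

/-- The number of squares `x ≤ y, z ≤ w` of invariant codes with `x ≤ p`, `y ≤ q`, `z ≤ c`,
`w ≤ s`. -/
noncomputable def belowCount (p q s c : ℕ) : ℕ :=
  sumL (filt (fun w => codeLE w s) symCodes) fun w =>
    sumL (filt (fun x => codeLE x w) (filt (fun x => codeLE x p) symCodes)) fun x =>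
      (sumL (between x w) fun y => Bool.toNat (codeLE y q)) *
        sumL (between x w) fun z => Bool.toNat (codeLE z c)

/-- The number of squares `x ≤ y, z ≤ w` of invariant codes with `p ≤ x`, `q ≤ y`, `c ≤ z`,
`s ≤ w`. -/
noncomputable def aboveCount (p q s c : ℕ) : ℕ :=
  sumL (filt (codeLE s) symCodes) fun w =>
    sumL (between p w) fun x =>
      (sumL (between x w) fun y => Bool.toNat (codeLE q y)) *
        sumL (between x w) fun z => Bool.toNat (codeLE c z)

theorem below_eq_pack (p q s : ℕ) : below p q s = pack monoCodes (belowCount p q s) := by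
  unfold below belowInner upTerm upRow belowCount
  simp only [Nat.mul_eq, sumL_pack, mul_pack]

theorem above_eq_pack (p q s : ℕ) : above p q s = pack monoCodes.reverse (aboveCount p q s) := by
  unfold above aboveInner downTerm downRow aboveCount
  simp only [Nat.mul_eq, sumL_pack, mul_pack]

theorem length_filt_le (p : ℕ → Bool) (l : List ℕ) : (filt p l).length ≤ l.length := by
  rw [filt_eq]; exact List.length_filter_le p l

theorem length_between_le (x w : ℕ) : (between x w).length ≤ 28 :=
  (length_filt_le _ _).trans (length_filt_le _ symCodes)

theorem belowCount_le (p q s c : ℕ) : belowCount p q s c ≤ 28 ^ 4 := by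
  refine (sumL_le (length_filt_le _ symCodes) fun w _ => sumL_le
    ((length_filt_le _ _).trans (length_filt_le _ symCodes)) fun x _ => Nat.mul_le_mul
      (sumL_le (length_between_le x w) fun y _ => Bool.toNat_le _)
      (sumL_le (length_between_le x w) fun z _ => Bool.toNat_le _)).trans ?_
  decide

theorem aboveCount_le (p q s c : ℕ) : aboveCount p q s c ≤ 28 ^ 4 := by
  refine (sumL_le (length_filt_le _ symCodes) fun w _ => sumL_le
    (length_between_le p w) fun x _ => Nat.mul_le_mul
      (sumL_le (length_between_le x w) fun y _ => Bool.toNat_le _)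
      (sumL_le (length_between_le x w) fun z _ => Bool.toNat_le _)).trans ?_
  decide

theorem codeLE_floorSym : ∀ x ∈ symCodes, ∀ a ∈ monoCodes, codeLE x (floorSym a) = codeLE x a := by
  decide +kernel

theorem ceilSym_codeLE : ∀ x ∈ symCodes, ∀ a ∈ monoCodes, codeLE (ceilSym a) x = codeLE a x := by
  decide +kernel

theorem mem_symCodes_of_mem_between {x w z : ℕ} (h : z ∈ between x w) : z ∈ symCodes := by
  simp only [between, filt_eq, List.mem_filter] at h
  exact h.1.1

theorem belowCount_floorSym {a b d : ℕ} (ha : a ∈ monoCodes) (hb : b ∈ monoCodes)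
    (hd : d ∈ monoCodes) (c : ℕ) :
    belowCount (floorSym a) (floorSym b) (floorSym d) c = belowCount a b d c := by
  have h {e : ℕ} (he : e ∈ monoCodes) : filt (fun w => codeLE w (floorSym e)) symCodes =
      filt (fun w => codeLE w e) symCodes := by
    rw [filt_eq, filt_eq]
    exact List.filter_congr fun x hx => codeLE_floorSym x hx e he
  unfold belowCount
  rw [h ha, h hd]
  refine sumL_congr fun w _ => sumL_congr fun x _ => ?_
  congr 1
  exact sumL_congr fun y hy => by rw [codeLE_floorSym y (mem_symCodes_of_mem_between hy) b hb]

theorem aboveCount_ceilSym {a b d : ℕ} (ha : a ∈ monoCodes) (hb : b ∈ monoCodes)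
    (hd : d ∈ monoCodes) (c : ℕ) :
    aboveCount (ceilSym a) (ceilSym b) (ceilSym d) c = aboveCount a b d c := by
  have h {e : ℕ} (he : e ∈ monoCodes) : filt (codeLE (ceilSym e)) symCodes =
      filt (codeLE e) symCodes := by
    rw [filt_eq, filt_eq]
    exact List.filter_congr fun x hx => ceilSym_codeLE x hx e he
  unfold aboveCount
  rw [h hd]
  refine sumL_congr fun w _ => ?_
  have h' : between (ceilSym a) w = between a w := by rw [between, between, h ha]
  rw [h']
  refine sumL_congr fun x _ => ?_
  congr 1
  exact sumL_congr fun y hy => by rw [ceilSym_codeLE y (mem_symCodes_of_mem_between hy) b hb]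

theorem mask_above (p q s a d : ℕ) :
    above p q s &&& (upMask a &&& downMask d) = pack monoCodes.reverse fun c =>
      aboveCount p q s c * Bool.toNat (codeLE a c && codeLE c d) := by
  have hb (b : Bool) : (radix - 1) * b.toNat < radix := by cases b <;> decide
  have hlt (c : ℕ) : aboveCount p q s c < radix := (aboveCount_le p q s c).trans_lt (by decide)
  have hand (x : ℕ) (hx : x < radix) : x &&& (radix - 1) = x := by
    have hr : radix = 2 ^ 80 := rfl
    rw [hr] at hx ⊢
    rw [Nat.and_two_pow_sub_one_eq_mod, Nat.mod_eq_of_lt hx]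
  rw [above_eq_pack, upMask, downMask]
  simp only [Nat.mul_eq, Nat.sub_eq]
  rw [land_pack _ (fun c _ => hb _) fun c _ => hb _,
    land_pack _ (fun c _ => hlt c) fun c _ => Nat.lt_of_le_of_lt Nat.and_le_left (hb _)]
  congr 1
  funext c
  cases codeLE a c <;> cases codeLE c d <;> simp [hand _ (hlt c)]

/-- The number of pairs of squares of invariant codes, one below and one above a square
`a ≤ b, c ≤ d` of monotone codes with `a ∈ l`. -/
noncomputable def squareCount (l : List ℕ) : ℕ :=
  sumL l fun a => sumL (filt (codeLE a) monoCodes) fun b =>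
    sumL (filt (codeLE b) monoCodes) fun d => sumL monoCodes fun c =>
      belowCount a b d c * (aboveCount a b d c * Bool.toNat (codeLE a c && codeLE c d))

theorem length_monoCodes : monoCodes.length = 167 + 1 := by decide +kernel

theorem squareCount_eq_mod {l : List ℕ} (hl : l ⊆ monoCodes) (hlen : l.length ≤ 168) :
    squareCount l = total l / radix ^ 167 % radix := by
  have hmem {a b : ℕ} (h : b ∈ filt (codeLE a) monoCodes) : b ∈ monoCodes := by
    rw [filt_eq] at h; exact List.mem_of_mem_filter h
  have key : HasCoeff (167 + 1) (total l) (squareCount l)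
      (168 * (168 * (168 * ((168 * 28 ^ 4) * (168 * 28 ^ 4))))) := by
    unfold total squareCount
    simp only [force_eq]
    refine HasCoeff.sumL hlen fun a ha => HasCoeff.sumL (length_filt_le _ monoCodes) fun b hb =>
      HasCoeff.sumL (length_filt_le _ monoCodes) fun d hd => ?_
    have h := HasCoeff.pack_mul_pack monoCodes (belowCount a b d) fun c =>
      aboveCount a b d c * Bool.toNat (codeLE a c && codeLE c d)
    rw [length_monoCodes] at h
    have hB : below (floorSym a) (floorSym b) (floorSym d) = pack monoCodes (belowCount a b d) := by
      rw [below_eq_pack]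
      congr 1
      exact funext (belowCount_floorSym (hl ha) (hmem hb) (hmem hd))
    have hA : Nat.land (above (ceilSym a) (ceilSym b) (ceilSym d))
        (Nat.land (upMask a) (downMask d)) = pack monoCodes.reverse fun c =>
          aboveCount a b d c * Bool.toNat (codeLE a c && codeLE c d) := by
      refine (mask_above _ _ _ a d).trans ?_
      congr 1
      funext c
      rw [aboveCount_ceilSym (hl ha) (hmem hb) (hmem hd)]
    rw [hB, hA]
    refine h.mono (Nat.mul_le_mul (sumL_le le_rfl fun c _ => belowCount_le a b d c)
      (sumL_le le_rfl fun c _ => ?_))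
    exact (Nat.mul_le_mul (aboveCount_le a b d c) (Bool.toNat_le _)).trans (by simp)
  exact key.eq_mod (by decide)

/-- The function of `n` variables whose truth table is coded by `m`. -/
def decode {n : ℕ} (m : ℕ) (x : Fin n → Bool) : Bool := m.testBit (Nat.ofBits x)

/-- The codes of the monotone functions of `n` variables. -/
def monoTables : ℕ → List ℕ
  | 0 => [0, 1]
  | n + 1 => (monoTables n).flatMap fun g =>
      ((monoTables n).filter (codeLE g)).map fun h => 2 ^ 2 ^ n * h + g

theorem monoTables_four : monoTables 4 = monoCodes := by decide +kernel

theorem nodup_monoCodes : monoCodes.Nodup := by decide +kernel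

theorem nodup_symCodes : symCodes.Nodup := by decide +kernel

theorem codeLE_eq_true {m m' : ℕ} : codeLE m m' = true ↔ m &&& m' = m := by
  simp [codeLE]

theorem codeLE_iff_decode {n m m' : ℕ} (hm : m < 2 ^ 2 ^ n) :
    codeLE m m' = true ↔ ∀ x : Fin n → Bool, decode m x ≤ decode m' x := by
  rw [codeLE_eq_true]
  constructor
  · intro h x
    rw [decode, decode, ← h, Nat.testBit_and]
    exact Bool.and_le_right _ _
  · intro h
    refine Nat.eq_of_testBit_eq fun i => ?_
    rw [Nat.testBit_and]
    rcases lt_or_ge i (2 ^ n) with hi | hi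
    · have := h fun j => i.testBit j
      rw [decode, decode, Nat.ofBits_testBit, Nat.mod_eq_of_lt hi] at this
      revert this
      cases m.testBit i <;> cases m'.testBit i <;> decide
    · rw [Nat.testBit_lt_two_pow (hm.trans_le (Nat.pow_le_pow_right two_pos hi)), Bool.false_and]

theorem ofBits_snoc {n : ℕ} (y : Fin n → Bool) (b : Bool) :
    Nat.ofBits (Fin.snoc y b : Fin (n + 1) → Bool) = 2 ^ n * b.toNat + Nat.ofBits y := by
  refine Nat.eq_of_testBit_eq fun i => ?_
  rw [Nat.testBit_two_pow_mul_add _ (Nat.ofBits_lt_two_pow y), Nat.testBit_ofBits]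
  rcases lt_trichotomy i n with h | rfl | h
  · rw [dif_pos (by lia), if_pos h, Nat.testBit_ofBits_lt _ _ h]
    exact Fin.snoc_castSucc (α := fun _ => Bool) b y ⟨i, h⟩
  · rw [dif_pos (by lia), if_neg (by lia)]
    refine (Fin.snoc_last (α := fun _ => Bool) b y).trans ?_
    cases b <;> simp
  · rw [dif_neg (by lia), if_neg (by lia), Nat.testBit_lt_two_pow]
    exact (Bool.toNat_lt b).trans_le (Nat.le_self_pow (by lia) 2)

theorem decode_snoc {n g h : ℕ} (hg : g < 2 ^ 2 ^ n) (y : Fin n → Bool) (b : Bool) :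
    decode (2 ^ 2 ^ n * h + g) (Fin.snoc y b : Fin (n + 1) → Bool) =
      if b then decode h y else decode g y := by
  have hy := Nat.ofBits_lt_two_pow y
  rw [decode, ofBits_snoc, Nat.testBit_two_pow_mul_add _ hg]
  cases b <;> simp [decode, hy]

theorem snoc_le_snoc {n : ℕ} {y y' : Fin n → Bool} {b b' : Bool} (hy : y ≤ y') (hb : b ≤ b') :
    (Fin.snoc y b : Fin (n + 1) → Bool) ≤ Fin.snoc y' b' := by
  intro i
  refine Fin.lastCases ?_ (fun j => ?_) i
  · simpa using hb
  · simpa using hy j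

theorem not_true_le_false : ¬ true ≤ false := by decide

theorem monotone_decode_of_mem {n m : ℕ} (h : m ∈ monoTables n) :
    m < 2 ^ 2 ^ n ∧ Monotone (decode m : (Fin n → Bool) → Bool) := by
  induction n generalizing m with
  | zero =>
    refine ⟨?_, fun x y _ => by rw [Subsingleton.elim x y]⟩
    simp only [monoTables, List.mem_cons, List.not_mem_nil, or_false] at h
    rcases h with rfl | rfl <;> decide
  | succ n ih =>
    simp only [monoTables, List.mem_flatMap, List.mem_map, List.mem_filter] at h
    obtain ⟨g, hg, k, ⟨hk, hgk⟩, rfl⟩ := h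
    obtain ⟨hg1, hg2⟩ := ih hg
    obtain ⟨hk1, hk2⟩ := ih hk
    refine ⟨?_, fun x x' hx => ?_⟩
    · rw [pow_succ 2 n, pow_mul, sq]
      nlinarith
    · rw [← Fin.snoc_init_self x, ← Fin.snoc_init_self x', decode_snoc hg1, decode_snoc hg1]
      have h1 : Fin.init x ≤ Fin.init x' := fun i => hx _
      have h2 := hx (Fin.last n)
      have h3 := (codeLE_iff_decode hg1).1 hgk
      revert h2
      cases x (Fin.last n) <;> cases x' (Fin.last n) <;> intro h2
      · exact hg2 h1
      · exact (hg2 h1).trans (h3 _)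
      · exact absurd h2 not_true_le_false
      · exact hk2 h1

theorem exists_mem_monoTables {n : ℕ} {g : (Fin n → Bool) → Bool} (hg : Monotone g) :
    ∃ m ∈ monoTables n, decode m = g := by
  induction n with
  | zero =>
    refine ⟨(g default).toNat, ?_, funext fun x => ?_⟩
    · cases g default <;> simp [monoTables]
    · rw [Subsingleton.elim x default]
      cases g default <;> rfl
  | succ n ih =>
    obtain ⟨m, hm, hmg⟩ := ih (g := fun y => g (Fin.snoc y false))
      fun y y' h => hg (snoc_le_snoc h le_rfl)
    obtain ⟨k, hk, hkg⟩ := ih (g := fun y => g (Fin.snoc y true))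
      fun y y' h => hg (snoc_le_snoc h le_rfl)
    have hm1 := (monotone_decode_of_mem hm).1
    refine ⟨2 ^ 2 ^ n * k + m, ?_, funext fun x => ?_⟩
    · simp only [monoTables, List.mem_flatMap, List.mem_map, List.mem_filter]
      refine ⟨m, hm, k, ⟨hk, (codeLE_iff_decode hm1).2 fun y => ?_⟩, rfl⟩
      rw [hmg, hkg]
      exact hg (snoc_le_snoc le_rfl (by decide))
    · rw [← Fin.snoc_init_self x, decode_snoc hm1, hmg, hkg]
      cases x (Fin.last n) <;> rfl

theorem monotone_decode {m : ℕ} (h : m ∈ monoCodes) :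
    Monotone (decode m : (Fin 4 → Bool) → Bool) :=
  (monotone_decode_of_mem (monoTables_four ▸ h)).2

theorem exists_mem_monoCodes {g : (Fin 4 → Bool) → Bool} (hg : Monotone g) :
    ∃ m ∈ monoCodes, decode m = g :=
  monoTables_four ▸ exists_mem_monoTables hg

theorem codeLE_iff {m m' : ℕ} (hm : m ∈ monoCodes) :
    codeLE m m' = true ↔ ∀ x : Fin 4 → Bool, decode m x ≤ decode m' x :=
  codeLE_iff_decode (monotone_decode_of_mem (monoTables_four ▸ hm)).1

theorem decode_injOn : Set.InjOn (decode (n := 4)) {m | m ∈ monoCodes} := by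
  intro m hm m' hm' h
  have h1 := (codeLE_iff hm (m' := m')).2 fun x => (congrFun h x).le
  have h2 := (codeLE_iff hm' (m' := m)).2 fun x => (congrFun h x).ge
  rw [codeLE_eq_true] at h1 h2
  rw [← h1, Nat.land_comm, h2]

theorem symCodes_subset : symCodes ⊆ monoCodes := by decide +kernel

theorem mem_symCodes_iff : ∀ m ∈ monoCodes, m ∈ symCodes ↔
    ∀ x₀ x₁ x₂ x₃ : Bool, decode m ![x₁, x₀, x₃, x₂] = decode m ![x₀, x₁, x₂, x₃] := by
  decide +kernel

theorem nodup_filt {l : List ℕ} (hl : l.Nodup) (p : ℕ → Bool) : (filt p l).Nodup := by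
  rw [filt_eq]; exact hl.filter p

theorem nodup_between (x w : ℕ) : (between x w).Nodup :=
  nodup_filt (nodup_filt nodup_symCodes _) _

theorem sumL_toNat {l : List ℕ} (hl : l.Nodup) (p : ℕ → Bool) :
    sumL l (fun a => Bool.toNat (p a)) = (l.toFinset.filter fun a => p a = true).card := by
  rw [sumL_eq_sum hl, Finset.card_filter]
  exact Finset.sum_congr rfl fun a _ => by cases p a <;> rfl

/-- A square `x ≤ y, z ≤ w` of codes, in the order `w, x, y, z`. -/
abbrev Square : Type := Σ _ : ℕ, Σ _ : ℕ, ℕ × ℕ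

/-- A square `a ≤ b, c ≤ d` of codes, in the order `a, b, d, c`, with a square below it and a
square above it. -/
abbrev SquarePair : Type := Σ _ : ℕ, Σ _ : ℕ, Σ _ : ℕ, Σ _ : ℕ, Square × Square

/-- The squares counted by `belowCount`. -/
noncomputable def belowSet (p q s c : ℕ) : Finset Square :=
  (filt (fun w => codeLE w s) symCodes).toFinset.sigma fun w =>
    (filt (fun x => codeLE x w) (filt (fun x => codeLE x p) symCodes)).toFinset.sigma fun x =>
      ((between x w).toFinset.filter fun y => codeLE y q = true) ×ˢ
        (between x w).toFinset.filter fun z => codeLE z c = true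

/-- The squares counted by `aboveCount`. -/
noncomputable def aboveSet (p q s c : ℕ) : Finset Square :=
  (filt (codeLE s) symCodes).toFinset.sigma fun w =>
    (between p w).toFinset.sigma fun x =>
      ((between x w).toFinset.filter fun y => codeLE q y = true) ×ˢ
        (between x w).toFinset.filter fun z => codeLE c z = true

/-- The pairs of squares counted by `squareCount monoCodes`. -/
noncomputable def squareSet : Finset SquarePair :=
  monoCodes.toFinset.sigma fun a => (filt (codeLE a) monoCodes).toFinset.sigma fun b =>
    (filt (codeLE b) monoCodes).toFinset.sigma fun d =>
      (monoCodes.toFinset.filter fun c => (codeLE a c && codeLE c d) = true).sigma fun c =>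
        belowSet a b d c ×ˢ aboveSet a b d c

theorem card_belowSet (p q s c : ℕ) : (belowSet p q s c).card = belowCount p q s c := by
  have h := nodup_symCodes
  simp only [belowSet, belowCount, Finset.card_sigma, Finset.card_product,
    sumL_toNat (nodup_between _ _)]
  rw [sumL_eq_sum (nodup_filt h _)]
  exact Finset.sum_congr rfl fun w _ => by rw [sumL_eq_sum (nodup_filt (nodup_filt h _) _)]

theorem card_aboveSet (p q s c : ℕ) : (aboveSet p q s c).card = aboveCount p q s c := by
  simp only [aboveSet, aboveCount, Finset.card_sigma, Finset.card_product,
    sumL_toNat (nodup_between _ _)]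
  rw [sumL_eq_sum (nodup_filt nodup_symCodes _)]
  exact Finset.sum_congr rfl fun w _ => by rw [sumL_eq_sum (nodup_between _ _)]

theorem card_squareSet : squareSet.card = squareCount monoCodes := by
  have h := nodup_monoCodes
  simp only [squareSet, squareCount, Finset.card_sigma, Finset.card_product, card_belowSet,
    card_aboveSet]
  rw [sumL_eq_sum h]
  refine Finset.sum_congr rfl fun a _ => ?_
  rw [sumL_eq_sum (nodup_filt h _)]
  refine Finset.sum_congr rfl fun b _ => ?_
  rw [sumL_eq_sum (nodup_filt h _)]
  refine Finset.sum_congr rfl fun d _ => ?_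
  rw [sumL_eq_sum h, Finset.sum_filter]
  refine Finset.sum_congr rfl fun c _ => ?_
  cases codeLE a c && codeLE c d <;> simp

/-- The entry in position `(u, v)` of the square `x ≤ y, z ≤ w`. -/
def corner (x y z w : ℕ) (u v : Bool) : ℕ := bif u then bif v then w else z else bif v then y else x

/-- The invariant function with the given restrictions to `X 4 = X 5 = false`, to
`X 4 = false, X 5 = true`, and to `X 4 = X 5 = true`. -/
def glue (L M H : Bool → Bool → (Fin 4 → Bool) → Bool) (X : Fin 8 → Bool) : Bool :=
  bif X 4 then
    bif X 5 then H (X 6) (X 7) ![X 0, X 1, X 2, X 3] else M (X 6) (X 7) ![X 1, X 0, X 3, X 2]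
  else
    bif X 5 then M (X 6) (X 7) ![X 0, X 1, X 2, X 3] else L (X 6) (X 7) ![X 0, X 1, X 2, X 3]

theorem comp_perm (X : Fin 8 → Bool) :
    X ∘ (Equiv.swap 0 1 * Equiv.swap 2 3 * Equiv.swap 4 5 : Equiv.Perm (Fin 8)) =
      ![X 1, X 0, X 3, X 2, X 5, X 4, X 6, X 7] := by
  funext i
  fin_cases i <;> exact congrArg X (by decide)

theorem eq_vec_four (p : Fin 4 → Bool) : ![p 0, p 1, p 2, p 3] = p := by
  funext i; fin_cases i <;> rfl

theorem eq_vec_eight (X : Fin 8 → Bool) :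
    ![X 0, X 1, X 2, X 3, X 4, X 5, X 6, X 7] = X := by
  funext i; fin_cases i <;> rfl

theorem vec_four_le {a b c d a' b' c' d' : Bool} (ha : a ≤ a') (hb : b ≤ b') (hc : c ≤ c')
    (hd : d ≤ d') : ![a, b, c, d] ≤ ![a', b', c', d'] := by
  intro i; fin_cases i <;> assumption

theorem vec_eight_le {p q : Fin 4 → Bool} (hp : p ≤ q) {a b c d a' b' c' d' : Bool}
    (ha : a ≤ a') (hb : b ≤ b') (hc : c ≤ c') (hd : d ≤ d') :
    ![p 0, p 1, p 2, p 3, a, b, c, d] ≤ ![q 0, q 1, q 2, q 3, a', b', c', d'] := by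
  intro i; fin_cases i <;> first | assumption | exact hp _

/-- Monotonicity in all three arguments. -/
def Mono₃ (L : Bool → Bool → (Fin 4 → Bool) → Bool) : Prop :=
  ∀ ⦃u u' v v' p p'⦄, u ≤ u' → v ≤ v' → p ≤ p' → L u v p ≤ L u' v' p'

/-- Invariance under `(0 1)(2 3)`. -/
def Sym₃ (L : Bool → Bool → (Fin 4 → Bool) → Bool) : Prop :=
  ∀ u v x₀ x₁ x₂ x₃, L u v ![x₁, x₀, x₃, x₂] = L u v ![x₀, x₁, x₂, x₃]

theorem monotone_glue {L M H : Bool → Bool → (Fin 4 → Bool) → Bool} (hL : Mono₃ L) (hM : Mono₃ M)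
    (hH : Mono₃ H) (hLM : L ≤ M) (hMH : M ≤ H) (sL : Sym₃ L) (sH : Sym₃ H) :
    Monotone (glue L M H) := by
  intro X Y h
  have h6 := h 6
  have h7 := h 7
  have hp := vec_four_le (h 0) (h 1) (h 2) (h 3)
  have hq := vec_four_le (h 1) (h 0) (h 3) (h 2)
  have h4 := h 4
  have h5 := h 5
  unfold glue
  revert h4 h5
  cases X 4 <;> cases Y 4 <;> cases X 5 <;> cases Y 5 <;> intro h4 h5 <;>
    simp only [cond_true, cond_false] <;> first
    | exact hL h6 h7 hp
    | exact hM h6 h7 hp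
    | exact hM h6 h7 hq
    | exact hH h6 h7 hp
    | exact (hL h6 h7 hp).trans (hLM _ _ _)
    | exact (hL h6 h7 hp).trans ((hLM _ _ _).trans (hMH _ _ _))
    | exact (hM h6 h7 hp).trans (hMH _ _ _)
    | exact (sL _ _ _ _ _ _).symm.trans_le ((hL h6 h7 hq).trans (hLM _ _ _))
    | exact ((hM h6 h7 hq).trans (hMH _ _ _)).trans_eq (sH _ _ _ _ _ _)
    | exact absurd h4 not_true_le_false
    | exact absurd h5 not_true_le_false

theorem glue_comp_perm {L M H : Bool → Bool → (Fin 4 → Bool) → Bool} (sL : Sym₃ L) (sH : Sym₃ H)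
    (X : Fin 8 → Bool) :
    glue L M H (X ∘ (Equiv.swap 0 1 * Equiv.swap 2 3 * Equiv.swap 4 5 : Equiv.Perm (Fin 8))) =
      glue L M H X := by
  rw [comp_perm]
  change (bif X 5 then bif X 4 then H (X 6) (X 7) ![X 1, X 0, X 3, X 2]
      else M (X 6) (X 7) ![X 0, X 1, X 2, X 3]
    else bif X 4 then M (X 6) (X 7) ![X 1, X 0, X 3, X 2]
      else L (X 6) (X 7) ![X 1, X 0, X 3, X 2]) = _
  rw [sL, sH, glue]
  cases X 4 <;> cases X 5 <;> rfl

/-- The restriction of `f` to fixed values of the fifth and the sixth variable. -/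
def slice (f : (Fin 8 → Bool) → Bool) (s t u v : Bool) (p : Fin 4 → Bool) : Bool :=
  f ![p 0, p 1, p 2, p 3, s, t, u, v]

theorem glue_slice {f : (Fin 8 → Bool) → Bool}
    (hf : ∀ x : Fin 8 → Bool,
      f (x ∘ (Equiv.swap 0 1 * Equiv.swap 2 3 * Equiv.swap 4 5 : Equiv.Perm (Fin 8))) = f x) :
    glue (slice f false false) (slice f false true) (slice f true true) = f := by
  funext X
  rw [← eq_vec_eight X, ← hf]
  rw [comp_perm]
  generalize X 0 = x₀, X 1 = x₁, X 2 = x₂, X 3 = x₃, X 4 = x₄, X 5 = x₅, X 6 = x₆, X 7 = x₇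
  have h := hf ![x₀, x₁, x₂, x₃, x₄, x₅, x₆, x₇]
  rw [comp_perm] at h
  cases x₄ <;> cases x₅
  · exact h.symm
  · exact h.symm
  · rfl
  · exact h.symm

theorem slice_glue (L M H : Bool → Bool → (Fin 4 → Bool) → Bool) :
    slice (glue L M H) false false = L ∧ slice (glue L M H) false true = M ∧
      slice (glue L M H) true true = H := by
  refine ⟨?_, ?_, ?_⟩ <;> funext u v p <;> rw [← eq_vec_four p] <;> rfl

theorem mono₃_slice {f : (Fin 8 → Bool) → Bool} (hf : Monotone f) (s t : Bool) :
    Mono₃ (slice f s t) :=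
  fun _ _ _ _ _ _ hu hv hp => hf (vec_eight_le hp le_rfl le_rfl hu hv)

theorem slice_le_slice {f : (Fin 8 → Bool) → Bool} (hf : Monotone f) {s s' t t' : Bool}
    (hs : s ≤ s') (ht : t ≤ t') : slice f s t ≤ slice f s' t' :=
  fun _ _ _ => hf (vec_eight_le le_rfl hs ht le_rfl le_rfl)

theorem sym₃_slice {f : (Fin 8 → Bool) → Bool}
    (hf : ∀ x : Fin 8 → Bool,
      f (x ∘ (Equiv.swap 0 1 * Equiv.swap 2 3 * Equiv.swap 4 5 : Equiv.Perm (Fin 8))) = f x)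
    (s : Bool) : Sym₃ (slice f s s) := fun u v x₀ x₁ x₂ x₃ => by
  have h := hf ![x₀, x₁, x₂, x₃, s, s, u, v]
  rw [comp_perm] at h
  exact h

/-- The family of functions coded by a square. -/
def decodeSquare (x y z w : ℕ) (u v : Bool) : (Fin 4 → Bool) → Bool := decode (corner x y z w u v)

theorem mono₃_decodeSquare {x y z w : ℕ} (hx : x ∈ monoCodes) (hy : y ∈ monoCodes)
    (hz : z ∈ monoCodes) (hw : w ∈ monoCodes) (hxy : codeLE x y = true) (hxz : codeLE x z = true)
    (hyw : codeLE y w = true) (hzw : codeLE z w = true) : Mono₃ (decodeSquare x y z w) := by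
  rw [codeLE_iff ‹_›] at hxy hxz hyw hzw
  intro u u' v v' p p' hu hv hp
  unfold decodeSquare
  have hm : corner x y z w u v ∈ monoCodes := by cases u <;> cases v <;> assumption
  refine (monotone_decode hm hp).trans ?_
  cases u <;> cases u' <;> cases v <;> cases v' <;> first
    | exact le_rfl
    | exact hxy p'
    | exact hxz p'
    | exact hyw p'
    | exact hzw p'
    | exact (hxy p').trans (hyw p')
    | exact absurd hu not_true_le_false
    | exact absurd hv not_true_le_false

theorem decodeSquare_le {x y z w x' y' z' w' : ℕ} (hx : x ∈ monoCodes) (hy : y ∈ monoCodes)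
    (hz : z ∈ monoCodes) (hw : w ∈ monoCodes) (hxx : codeLE x x' = true)
    (hyy : codeLE y y' = true) (hzz : codeLE z z' = true) (hww : codeLE w w' = true) :
    decodeSquare x y z w ≤ decodeSquare x' y' z' w' := by
  rw [codeLE_iff ‹_›] at hxx hyy hzz hww
  intro u v
  cases u <;> cases v <;> assumption

theorem sym₃_decodeSquare {x y z w : ℕ} (hx : x ∈ symCodes) (hy : y ∈ symCodes)
    (hz : z ∈ symCodes) (hw : w ∈ symCodes) : Sym₃ (decodeSquare x y z w) := by
  intro u v
  have hm : corner x y z w u v ∈ symCodes := by cases u <;> cases v <;> assumption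
  exact (mem_symCodes_iff _ (symCodes_subset hm)).1 hm

theorem decodeSquare_inj {x y z w x' y' z' w' : ℕ} (hx : x ∈ monoCodes) (hy : y ∈ monoCodes)
    (hz : z ∈ monoCodes) (hw : w ∈ monoCodes) (hx' : x' ∈ monoCodes) (hy' : y' ∈ monoCodes)
    (hz' : z' ∈ monoCodes) (hw' : w' ∈ monoCodes)
    (h : decodeSquare x y z w = decodeSquare x' y' z' w') :
    x = x' ∧ y = y' ∧ z = z' ∧ w = w' :=
  ⟨decode_injOn hx hx' (congrFun₂ h false false), decode_injOn hy hy' (congrFun₂ h false true),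
    decode_injOn hz hz' (congrFun₂ h true false), decode_injOn hw hw' (congrFun₂ h true true)⟩

theorem exists_decodeSquare {L : Bool → Bool → (Fin 4 → Bool) → Bool} (hL : Mono₃ L) :
    ∃ x ∈ monoCodes, ∃ y ∈ monoCodes, ∃ z ∈ monoCodes, ∃ w ∈ monoCodes,
      decodeSquare x y z w = L := by
  have h (u v : Bool) := exists_mem_monoCodes (g := L u v) fun _ _ hp => hL le_rfl le_rfl hp
  obtain ⟨x, hx, ex⟩ := h false false
  obtain ⟨y, hy, ey⟩ := h false true
  obtain ⟨z, hz, ez⟩ := h true false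
  obtain ⟨w, hw, ew⟩ := h true true
  refine ⟨x, hx, y, hy, z, hz, w, hw, ?_⟩
  funext u v
  cases u <;> cases v <;> assumption

theorem codeLE_of_mono₃ {x y z w : ℕ} (hx : x ∈ monoCodes) (hy : y ∈ monoCodes)
    (hz : z ∈ monoCodes) (h : Mono₃ (decodeSquare x y z w)) :
    codeLE x y = true ∧ codeLE x z = true ∧ codeLE y w = true ∧ codeLE z w = true := by
  have hb : false ≤ true := by decide
  simp only [codeLE_iff, hx, hy, hz]
  exact ⟨fun _ => h (le_refl false) hb le_rfl, fun _ => h hb (le_refl false) le_rfl,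
    fun _ => h hb (le_refl true) le_rfl, fun _ => h (le_refl true) hb le_rfl⟩

theorem codeLE_of_decodeSquare_le {x y z w x' y' z' w' : ℕ} (hx : x ∈ monoCodes)
    (hy : y ∈ monoCodes) (hz : z ∈ monoCodes) (hw : w ∈ monoCodes)
    (h : decodeSquare x y z w ≤ decodeSquare x' y' z' w') :
    codeLE x x' = true ∧ codeLE y y' = true ∧ codeLE z z' = true ∧ codeLE w w' = true := by
  simp only [codeLE_iff, hx, hy, hz, hw]
  exact ⟨h false false, h false true, h true false, h true true⟩

theorem mem_symCodes_of_sym₃ {x y z w : ℕ} (hx : x ∈ monoCodes) (hy : y ∈ monoCodes)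
    (hz : z ∈ monoCodes) (hw : w ∈ monoCodes) (h : Sym₃ (decodeSquare x y z w)) :
    x ∈ symCodes ∧ y ∈ symCodes ∧ z ∈ symCodes ∧ w ∈ symCodes := by
  simp only [mem_symCodes_iff, hx, hy, hz, hw]
  exact ⟨h false false, h false true, h true false, h true true⟩

theorem mem_squareSet {a b c d x y z w x' y' z' w' : ℕ} :
    (⟨a, b, d, c, ⟨w, x, y, z⟩, ⟨w', x', y', z'⟩⟩ : SquarePair) ∈ squareSet ↔
    ((a ∈ monoCodes ∧ b ∈ monoCodes ∧ c ∈ monoCodes ∧ d ∈ monoCodes) ∧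
      codeLE a b = true ∧ codeLE a c = true ∧ codeLE b d = true ∧ codeLE c d = true) ∧
    ((x ∈ symCodes ∧ y ∈ symCodes ∧ z ∈ symCodes ∧ w ∈ symCodes) ∧
      (codeLE x y = true ∧ codeLE x z = true ∧ codeLE y w = true ∧ codeLE z w = true) ∧
      codeLE x w = true ∧
      codeLE x a = true ∧ codeLE y b = true ∧ codeLE z c = true ∧ codeLE w d = true) ∧
    ((x' ∈ symCodes ∧ y' ∈ symCodes ∧ z' ∈ symCodes ∧ w' ∈ symCodes) ∧
      (codeLE x' y' = true ∧ codeLE x' z' = true ∧ codeLE y' w' = true ∧ codeLE z' w' = true) ∧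
      codeLE x' w' = true ∧
      codeLE a x' = true ∧ codeLE b y' = true ∧ codeLE c z' = true ∧ codeLE d w' = true) := by
  simp only [squareSet, belowSet, aboveSet, between, filt_eq, Finset.mem_sigma,
    Finset.mem_product, Finset.mem_filter, List.mem_toFinset, List.mem_filter, Bool.and_eq_true]
  tauto

theorem codeLE_trans {x y z : ℕ} (hxy : codeLE x y = true) (hyz : codeLE y z = true) :
    codeLE x z = true := by
  rw [codeLE_eq_true] at *
  rw [← hxy, Nat.land_assoc, hyz]

/-- The invariant function coded by a pair of squares and the square between them. -/
def assemble : SquarePair → (Fin 8 → Bool) → Bool :=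
  fun ⟨a, b, d, c, ⟨w, x, y, z⟩, ⟨w', x', y', z'⟩⟩ =>
    glue (decodeSquare x y z w) (decodeSquare a b c d) (decodeSquare x' y' z' w')

set_option linter.constructorNameAsVariable false in
theorem injOn_assemble : Set.InjOn assemble squareSet := by
  rintro ⟨a₁, b₁, d₁, c₁, ⟨w₁, x₁, y₁, z₁⟩, ⟨w₁', x₁', y₁', z₁'⟩⟩ h₁
    ⟨a₂, b₂, d₂, c₂, ⟨w₂, x₂, y₂, z₂⟩, ⟨w₂', x₂', y₂', z₂'⟩⟩ h₂ h
  rw [Finset.mem_coe, mem_squareSet] at h₁ h₂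
  obtain ⟨⟨⟨ha₁, hb₁, hc₁, hd₁⟩, -⟩, ⟨⟨hx₁, hy₁, hz₁, hw₁⟩, -⟩, ⟨hx₁', hy₁', hz₁', hw₁'⟩, -⟩ := h₁
  obtain ⟨⟨⟨ha₂, hb₂, hc₂, hd₂⟩, -⟩, ⟨⟨hx₂, hy₂, hz₂, hw₂⟩, -⟩, ⟨hx₂', hy₂', hz₂', hw₂'⟩, -⟩ := h₂
  have hsub := symCodes_subset
  obtain ⟨eL₁, eM₁, eH₁⟩ := slice_glue (decodeSquare x₁ y₁ z₁ w₁) (decodeSquare a₁ b₁ c₁ d₁)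
    (decodeSquare x₁' y₁' z₁' w₁')
  obtain ⟨eL₂, eM₂, eH₂⟩ := slice_glue (decodeSquare x₂ y₂ z₂ w₂) (decodeSquare a₂ b₂ c₂ d₂)
    (decodeSquare x₂' y₂' z₂' w₂')
  have h' : glue (decodeSquare x₁ y₁ z₁ w₁) (decodeSquare a₁ b₁ c₁ d₁)
    (decodeSquare x₁' y₁' z₁' w₁') = glue (decodeSquare x₂ y₂ z₂ w₂) (decodeSquare a₂ b₂ c₂ d₂)
    (decodeSquare x₂' y₂' z₂' w₂') := h
  rw [← h'] at eL₂ eM₂ eH₂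
  obtain ⟨rfl, rfl, rfl, rfl⟩ := decodeSquare_inj (hsub hx₁) (hsub hy₁) (hsub hz₁) (hsub hw₁)
    (hsub hx₂) (hsub hy₂) (hsub hz₂) (hsub hw₂) (eL₁.symm.trans eL₂)
  obtain ⟨rfl, rfl, rfl, rfl⟩ := decodeSquare_inj ha₁ hb₁ hc₁ hd₁ ha₂ hb₂ hc₂ hd₂
    (eM₁.symm.trans eM₂)
  obtain ⟨rfl, rfl, rfl, rfl⟩ := decodeSquare_inj (hsub hx₁') (hsub hy₁') (hsub hz₁') (hsub hw₁')
    (hsub hx₂') (hsub hy₂') (hsub hz₂') (hsub hw₂') (eH₁.symm.trans eH₂)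
  rfl

set_option linter.constructorNameAsVariable false in
theorem card_fixed_eq_squareCount :
    Nat.card {f : (Fin 8 → Bool) → Bool // Monotone f ∧ ∀ x : Fin 8 → Bool,
      f (x ∘ (Equiv.swap 0 1 * Equiv.swap 2 3 * Equiv.swap 4 5 : Equiv.Perm (Fin 8))) = f x} =
      squareCount monoCodes := by
  rw [← card_squareSet, ← Set.ncard_coe_finset, ← injOn_assemble.ncard_image,
    ← Nat.card_coe_set_eq]
  have hsub := symCodes_subset
  suffices h : {f : (Fin 8 → Bool) → Bool | Monotone f ∧ ∀ x : Fin 8 → Bool,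
      f (x ∘ (Equiv.swap 0 1 * Equiv.swap 2 3 * Equiv.swap 4 5 : Equiv.Perm (Fin 8))) = f x} =
      assemble '' squareSet by rw [← h]; rfl
  ext f
  constructor
  · rintro ⟨hf, hs⟩
    have hb : false ≤ true := by decide
    obtain ⟨x, hx, y, hy, z, hz, w, hw, eL⟩ := exists_decodeSquare (mono₃_slice hf false false)
    obtain ⟨a, ha, b, hb', c, hc, d, hd, eM⟩ := exists_decodeSquare (mono₃_slice hf false true)
    obtain ⟨x', hx', y', hy', z', hz', w', hw', eH⟩ :=
      exists_decodeSquare (mono₃_slice hf true true)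
    have mL := codeLE_of_mono₃ hx hy hz (eL ▸ mono₃_slice hf false false)
    have mH := codeLE_of_mono₃ hx' hy' hz' (eH ▸ mono₃_slice hf true true)
    refine ⟨⟨a, b, d, c, ⟨w, x, y, z⟩, ⟨w', x', y', z'⟩⟩, ?_, ?_⟩
    · rw [Finset.mem_coe, mem_squareSet]
      exact ⟨⟨⟨ha, hb', hc, hd⟩, codeLE_of_mono₃ ha hb' hc (eM ▸ mono₃_slice hf false true)⟩,
        ⟨mem_symCodes_of_sym₃ hx hy hz hw (eL ▸ sym₃_slice hs false), mL,
          codeLE_trans mL.1 mL.2.2.1, codeLE_of_decodeSquare_le hx hy hz hw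
            (by rw [eL, eM]; exact slice_le_slice hf le_rfl hb)⟩,
        mem_symCodes_of_sym₃ hx' hy' hz' hw' (eH ▸ sym₃_slice hs true), mH,
          codeLE_trans mH.1 mH.2.2.1, codeLE_of_decodeSquare_le ha hb' hc hd
            (by rw [eM, eH]; exact slice_le_slice hf hb le_rfl)⟩
    · change glue (decodeSquare x y z w) (decodeSquare a b c d) (decodeSquare x' y' z' w') = f
      rw [eL, eM, eH, glue_slice hs]
  · rintro ⟨⟨a, b, d, c, ⟨w, x, y, z⟩, ⟨w', x', y', z'⟩⟩, h, rfl⟩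
    rw [Finset.mem_coe, mem_squareSet] at h
    obtain ⟨⟨⟨ha, hb, hc, hd⟩, hab, hac, hbd, hcd⟩, ⟨⟨hx, hy, hz, hw⟩, ⟨hxy, hxz, hyw, hzw⟩, -,
      hxa, hyb, hzc, hwd⟩, ⟨hx', hy', hz', hw'⟩, ⟨hxy', hxz', hyw', hzw'⟩, -,
      hax, hby, hcz, hdw⟩ := h
    have sL := sym₃_decodeSquare hx hy hz hw
    have sH := sym₃_decodeSquare hx' hy' hz' hw'
    exact ⟨monotone_glue
      (mono₃_decodeSquare (hsub hx) (hsub hy) (hsub hz) (hsub hw) hxy hxz hyw hzw)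
      (mono₃_decodeSquare ha hb hc hd hab hac hbd hcd)
      (mono₃_decodeSquare (hsub hx') (hsub hy') (hsub hz') (hsub hw') hxy' hxz' hyw' hzw')
      (decodeSquare_le (hsub hx) (hsub hy) (hsub hz) (hsub hw) hxa hyb hzc hwd)
      (decodeSquare_le ha hb hc hd hax hby hcz hdw) sL sH, glue_comp_perm sL sH⟩

theorem squareCount_append (l r : List ℕ) :
    squareCount (l ++ r) = squareCount l + squareCount r := sumL_append l r _

theorem coeff_total_take_six : total (monoCodes.take 6) / radix ^ 167 % radix = 2350728581102 := by
  decide +kernel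

theorem coeff_total_drop_six_take :
    total ((monoCodes.drop 6).take 14) / radix ^ 167 % radix = 1459760349408 := by
  decide +kernel

theorem coeff_total_drop_twenty_take :
    total ((monoCodes.drop 20).take 30) / radix ^ 167 % radix = 2948385099938 := by
  decide +kernel

theorem coeff_total_drop_fifty :
    total (monoCodes.drop 50) / radix ^ 167 % radix = 618796865452 := by
  decide +kernel

theorem squareCount_monoCodes : squareCount monoCodes = 7377670895900 := by
  have h : monoCodes = monoCodes.take 6 ++ (monoCodes.drop 6).take 14 ++
      (monoCodes.drop 20).take 30 ++ monoCodes.drop 50 := by decide +kernel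
  have hlen := length_monoCodes
  rw [h, squareCount_append, squareCount_append, squareCount_append,
    squareCount_eq_mod (List.take_subset _ _) (by grind), coeff_total_take_six,
    squareCount_eq_mod (List.Subset.trans (List.take_subset _ _) (List.drop_subset _ _)) (by grind),
    coeff_total_drop_six_take,
    squareCount_eq_mod (List.Subset.trans (List.take_subset _ _) (List.drop_subset _ _)) (by grind),
    coeff_total_drop_twenty_take,
    squareCount_eq_mod (List.drop_subset _ _) (by grind), coeff_total_drop_fifty]

end FixedMBF

/-- The number of monotone Boolean functions of 8 variables fixed by the
permutation (0 1)(2 3)(4 5) equals 7377670895900. -/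
theorem card_fixed_mbf :
    Nat.card {f : (Fin 8 → Bool) → Bool //
      Monotone f ∧ ∀ x : Fin 8 → Bool, f (x ∘ (Equiv.swap 0 1 * Equiv.swap 2 3 * Equiv.swap 4 5 : Equiv.Perm (Fin 8))) = f x} = 7377670895900 := by
  rw [FixedMBF.card_fixed_eq_squareCount, FixedMBF.squareCount_monoCodes]
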